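/- Let T be a tree with n vertices and exactly r branching vertices (1 ≤ r ≤ n/2 − 1) such that ξ^{ce}(T) is maximum among all n-vertex trees with exactly r branching vertices. Then T has no vertex of degree two; consequently the degree sequence of T is (d₁,…,d_r, 1,…,1) where each dᵢ ≥ 3. -/

import Mathlib

open Finset SimpleGraph

variable {V : Type*}

open Classical in
/-- The degree of a vertex `u` in a graph `G` (number of neighbors). -/
noncomputable def deg [Fintype V] (G : SimpleGraph V) (u : V) : ℕ :=
  (Finset.univ.filter (fun v => G.Adj u v)).card

/-- The eccentricity of a vertex `u`: the maximum distance from `u` to any vertex. -/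
noncomputable def ecc [Fintype V] (G : SimpleGraph V) (u : V) : ℕ :=
  Finset.univ.sup (fun v => G.dist u v)

/-- The connective eccentricity index `ξ^{ce}(G) = Σ_{u ∈ V} d(u)/ε(u)`. -/
noncomputable def cei [Fintype V] (G : SimpleGraph V) : ℝ :=
  ∑ u : V, (deg G u : ℝ) / (ecc G u)

/-- The number of branching vertices (vertices of degree at least 3) of `T`. -/
noncomputable def branchCount [Fintype V] (T : SimpleGraph V) : ℕ :=
  (Finset.univ.filter (fun v => 3 ≤ deg T v)).card

/-! ### Degree, eccentricity and isomorphisms -/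

lemma dist_le_ecc [Fintype V] (G : SimpleGraph V) (u v : V) : G.dist u v ≤ ecc G u :=
  Finset.le_sup (f := fun v => G.dist u v) (Finset.mem_univ v)

lemma exists_dist_eq_ecc [Fintype V] (G : SimpleGraph V) (u : V) : ∃ v, G.dist u v = ecc G u := by
  obtain ⟨v, -, hv⟩ := Finset.exists_mem_eq_sup Finset.univ ⟨u, Finset.mem_univ u⟩
    (fun v => G.dist u v)
  exact ⟨v, hv.symm⟩

lemma ecc_pos_of_adj [Fintype V] {G : SimpleGraph V} {u v : V} (h : G.Adj u v) : 0 < ecc G u := by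
  have := dist_le_ecc G u v
  rw [dist_eq_one_iff_adj.2 h] at this
  exact this

lemma deg_eq_degree [Fintype V] (G : SimpleGraph V) (u : V) [Fintype (G.neighborSet u)] :
    deg G u = G.degree u := by
  classical
  rw [deg, ← card_neighborFinset_eq_degree]
  congr 1
  ext v
  simp

lemma deg_iso {W : Type*} [Fintype V] [Fintype W] {G : SimpleGraph V} {H : SimpleGraph W}
    (f : G ≃g H) (u : V) : deg H (f u) = deg G u := by
  classical
  rw [deg_eq_degree, deg_eq_degree, f.degree_eq]

lemma dist_iso_le {W : Type*} {G : SimpleGraph V} {H : SimpleGraph W}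
    (f : G ≃g H) (hG : G.Connected) (u v : V) : H.dist (f u) (f v) ≤ G.dist u v := by
  obtain ⟨p, hp⟩ := hG.exists_walk_length_eq_dist u v
  rw [← hp, ← Walk.length_map f.toHom p]
  exact dist_le _

lemma ecc_iso_le {W : Type*} [Fintype V] [Fintype W] {G : SimpleGraph V} {H : SimpleGraph W}
    (f : G ≃g H) (hG : G.Connected) (u : V) : ecc H (f u) ≤ ecc G u := by
  refine Finset.sup_le fun w _ => ?_
  obtain ⟨v, rfl⟩ := f.surjective w
  exact (dist_iso_le f hG u v).trans (dist_le_ecc G u v)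

lemma ecc_iso {W : Type*} [Fintype V] [Fintype W] {G : SimpleGraph V} {H : SimpleGraph W}
    (f : G ≃g H) (hG : G.Connected) (u : V) : ecc H (f u) = ecc G u := by
  refine le_antisymm (ecc_iso_le f hG u) ?_
  simpa using ecc_iso_le f.symm (f.connected_iff.1 hG) (f u)

lemma cei_iso {W : Type*} [Fintype V] [Fintype W] {G : SimpleGraph V} {H : SimpleGraph W}
    (f : G ≃g H) (hG : G.Connected) : cei H = cei G :=
  (Fintype.sum_equiv f.toEquiv _ _ fun u => by
    change _ = (deg H (f u) : ℝ) / (ecc H (f u))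
    rw [deg_iso, ecc_iso f hG]).symm

lemma branchCount_iso {W : Type*} [Fintype V] [Fintype W] {G : SimpleGraph V} {H : SimpleGraph W}
    (f : G ≃g H) : branchCount H = branchCount G := by
  refine (Finset.card_equiv f.toEquiv fun u => ?_).symm
  have := deg_iso f u
  simp only [Finset.mem_filter, Finset.mem_univ, true_and]
  change _ ↔ 3 ≤ deg H (f u)
  rw [this]

/-! ### Distances in connected graphs and trees -/

lemma exists_adj_dist_add_one {G : SimpleGraph V} (hG : G.Connected) {x y : V} (h : x ≠ y) :
    ∃ z, G.Adj x z ∧ G.dist z y + 1 = G.dist x y := by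
  obtain ⟨p, hp⟩ := hG.exists_walk_length_eq_dist x y
  cases p with
  | nil => exact absurd rfl h
  | @cons _ z _ hz q =>
    refine ⟨z, hz, ?_⟩
    have h₁ := dist_le q
    have h₂ := hG.dist_triangle (u := x) (v := z) (w := y)
    rw [dist_eq_one_iff_adj.2 hz] at h₂
    rw [Walk.length_cons] at hp
    omega

lemma eq_of_adj_of_dist_add_one {T : SimpleGraph V} (hT : T.IsTree) {x b c d : V}
    (hc : T.Adj c b) (hd : T.Adj d b) (hcx : T.dist x b = T.dist x c + 1)
    (hdx : T.dist x b = T.dist x d + 1) : c = d := by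
  obtain ⟨p, hp⟩ := hT.connected.exists_walk_length_eq_dist x c
  obtain ⟨q, hq⟩ := hT.connected.exists_walk_length_eq_dist x d
  have hp' : (p.concat hc).IsPath :=
    Walk.isPath_of_length_eq_dist _ (by rw [Walk.length_concat, hp, hcx])
  have hq' : (q.concat hd).IsPath :=
    Walk.isPath_of_length_eq_dist _ (by rw [Walk.length_concat, hq, hdx])
  have := congrArg Walk.penultimate (hT.existsUnique_path x b |>.unique hp' hq')
  simpa using this

/-- Walking away from `x` is possible at every vertex of a tree of degree at least two. -/
lemma exists_dist_eq_add_one_of_two_le_deg [Fintype V] {T : SimpleGraph V} (hT : T.IsTree) {b : V}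
    (hb : 2 ≤ deg T b) (x : V) : ∃ c, T.dist x c = T.dist x b + 1 := by
  classical
  obtain ⟨c, hc, d, hd, hcd⟩ := Finset.one_lt_card.1 (show 1 < _ from hb)
  simp only [Finset.mem_filter, Finset.mem_univ, true_and] at hc hd
  rcases hT.dist_eq_dist_add_one_of_adj x hc with h₁ | h₁
  · rcases hT.dist_eq_dist_add_one_of_adj x hd with h₂ | h₂
    · exact absurd (eq_of_adj_of_dist_add_one hT hc.symm hd.symm h₁ h₂) hcd
    · exact ⟨d, h₂⟩
  · exact ⟨c, h₁⟩

lemma exists_ne_adj_of_deg_eq_two [Fintype V] {G : SimpleGraph V} {v b : V}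
    (hv : deg G v = 2) (hb : G.Adj v b) :
    ∃ w, w ≠ b ∧ ∀ x, G.Adj v x ↔ x = b ∨ x = w := by
  classical
  obtain ⟨c, d, hcd, h⟩ := Finset.card_eq_two.1 hv
  have key : ∀ x, G.Adj v x ↔ x = c ∨ x = d := fun x => by
    simpa using Finset.ext_iff.1 h x
  rcases (key b).1 hb with rfl | rfl
  · exact ⟨d, hcd.symm, key⟩
  · exact ⟨c, hcd, fun x => (key x).trans or_comm⟩

/-- If both degree-two and branching vertices occur, then two of them are adjacent. -/
lemma exists_adj_deg_eq_two_three_le_deg [Fintype V] {G : SimpleGraph V} (hG : G.Connected)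
    {v₀ b₀ : V} (hv₀ : deg G v₀ = 2) (hb₀ : 3 ≤ deg G b₀) :
    ∃ v b, G.Adj v b ∧ deg G v = 2 ∧ 3 ≤ deg G b := by
  classical
  obtain ⟨v, hv, hmin⟩ := Finset.exists_min_image (Finset.univ.filter fun v => deg G v = 2)
    (fun v => G.dist v b₀) ⟨v₀, by simpa using hv₀⟩
  simp only [Finset.mem_filter, Finset.mem_univ, true_and] at hv hmin
  have hvb : v ≠ b₀ := by rintro rfl; omega
  obtain ⟨z, hvz, hz⟩ := exists_adj_dist_add_one hG hvb
  refine ⟨v, z, hvz, hv, ?_⟩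
  by_cases hzb : z = b₀
  · rwa [hzb]
  obtain ⟨y, hzy, hy⟩ := exists_adj_dist_add_one hG hzb
  have hne : v ≠ y := by rintro rfl; omega
  have h2 : 1 < deg G z :=
    Finset.one_lt_card.2 ⟨v, by simpa using hvz.symm, y, by simpa using hzy, hne⟩
  have h3 : deg G z ≠ 2 := fun h => by have := hmin z h; omega
  omega

lemma two_div_add_div_lt {d p q p' q' : ℕ} (hd : 2 ≤ d) (hp' : 0 < p') (hq' : 0 < q')
    (hpq' : p' ≤ q' + 1) (hq : q' ≤ q) (h : q' < p ∨ (q' ≤ p ∧ p < q)) :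
    (2 : ℝ) / p + d / q < 1 / p' + (d + 1) / q' := by
  have hp'R : (0 : ℝ) < p' := by exact_mod_cast hp'
  have hq'R : (0 : ℝ) < q' := by exact_mod_cast hq'
  have hdR : (2 : ℝ) ≤ d := by exact_mod_cast hd
  rcases h with h | ⟨h₁, h₂⟩
  · have e₁ : (1 : ℝ) / p ≤ 1 / p' :=
      one_div_le_one_div_of_le hp'R (by exact_mod_cast (by omega : p' ≤ p))
    have e₂ : (1 : ℝ) / p < 1 / q' := one_div_lt_one_div_of_lt hq'R (by exact_mod_cast h)
    have e₃ : (d : ℝ) / q ≤ d / q' :=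
      div_le_div_of_nonneg_left (by positivity) hq'R (by exact_mod_cast hq)
    have e₄ : (2 : ℝ) / p = 1 / p + 1 / p := by ring
    rw [add_div, e₄]
    linarith
  · have e₁ : (1 : ℝ) / q ≤ 1 / p' :=
      one_div_le_one_div_of_le hp'R (by exact_mod_cast (by omega : p' ≤ q))
    have e₂ : (2 : ℝ) / p ≤ 2 / q' :=
      div_le_div_of_nonneg_left (by norm_num) hq'R (by exact_mod_cast h₁)
    have e₃ : ((d : ℝ) - 1) / q < (d - 1) / q' :=
      div_lt_div_of_pos_left (by linarith) hq'R (by exact_mod_cast (by omega : q' < q))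
    have e₄ : (d : ℝ) / q = 1 / q + (d - 1) / q := by ring
    have e₅ : ((d : ℝ) + 1) / q' = 2 / q' + (d - 1) / q' := by ring
    rw [e₄, e₅]
    linarith

/-! ### Making a degree-two neighbor pendant -/

/-- The graph obtained from `G` by isolating `v` and adding the edges `bv` and `bw`. If the
neighbors of `v` in `G` are `b` and `w`, this slides the edge `vw` to `bw`. -/
def slideEdge (G : SimpleGraph V) (v b w : V) : SimpleGraph V :=
  SimpleGraph.fromRel fun x y =>
    (G.Adj x y ∧ x ≠ v ∧ y ≠ v) ∨ (x = b ∧ y = v) ∨ (x = b ∧ y = w)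

section Slide

variable {T : SimpleGraph V} {v b w : V}

lemma slideEdge_adj {G : SimpleGraph V} {x y : V} (hbv : b ≠ v) (hbw : b ≠ w) :
    (slideEdge G v b w).Adj x y ↔ (G.Adj x y ∧ x ≠ v ∧ y ≠ v) ∨ (x = b ∧ y = v) ∨
      (x = v ∧ y = b) ∨ (x = b ∧ y = w) ∨ (x = w ∧ y = b) := by
  have h₁ : G.Adj x y → x ≠ y := fun h => h.ne
  have h₂ : G.Adj x y ↔ G.Adj y x := G.adj_comm x y
  simp only [slideEdge, fromRel_adj]
  grind

lemma exists_walk_slideEdge (hT : T.Connected) (hbw : b ≠ w) (hv : ∀ x, T.Adj v x ↔ x = b ∨ x = w)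
    (k : ℕ) : ∀ x y, x ≠ v → y ≠ v → T.dist x y = k →
      ∃ p : (slideEdge T v b w).Walk x y, p.length ≤ k := by
  have hbv : b ≠ v := ((hv b).2 (Or.inl rfl)).ne'
  induction k using Nat.strong_induction_on with
  | _ k ih =>
  intro x y hx hy hk
  by_cases hxy : x = y
  · subst hxy
    exact ⟨Walk.nil, by simp⟩
  obtain ⟨z, hxz, hz⟩ := exists_adj_dist_add_one hT hxy
  by_cases hzv : z = v
  · subst hzv
    obtain ⟨u, hzu, hu⟩ := exists_adj_dist_add_one hT (Ne.symm hy)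
    have hux : u ≠ x := by rintro rfl; omega
    obtain ⟨p, hp⟩ := ih (T.dist u y) (by omega) u y hzu.ne' hy rfl
    have hadj : (slideEdge T z b w).Adj x u := by
      rw [slideEdge_adj hbv hbw]
      have h₁ := (hv x).1 hxz.symm
      have h₂ := (hv u).1 hzu
      grind
    exact ⟨Walk.cons hadj p, by rw [Walk.length_cons]; omega⟩
  · obtain ⟨p, hp⟩ := ih (T.dist z y) (by omega) z y hzv hy rfl
    exact ⟨Walk.cons ((slideEdge_adj hbv hbw).2 (Or.inl ⟨hxz, hx, hzv⟩)) p, by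
      rw [Walk.length_cons]; omega⟩

lemma slideEdge_connected (hT : T.Connected) (hbw : b ≠ w)
    (hv : ∀ x, T.Adj v x ↔ x = b ∨ x = w) : (slideEdge T v b w).Connected := by
  have hbv : b ≠ v := ((hv b).2 (Or.inl rfl)).ne'
  have hb : ∀ x, (slideEdge T v b w).Reachable b x := by
    intro x
    by_cases hx : x = v
    · subst hx
      exact Adj.reachable ((slideEdge_adj hbv hbw).2 (by simp))
    · exact ⟨(exists_walk_slideEdge hT hbw hv _ b x hbv hx rfl).choose⟩
  exact connected_iff_exists_forall_reachable _ |>.2 ⟨b, hb⟩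

lemma dist_slideEdge_le (hT : T.Connected) (hbw : b ≠ w) (hv : ∀ x, T.Adj v x ↔ x = b ∨ x = w)
    {x y : V} (hx : x ≠ v) (hy : y ≠ v) : (slideEdge T v b w).dist x y ≤ T.dist x y := by
  obtain ⟨p, hp⟩ := exists_walk_slideEdge hT hbw hv _ x y hx hy rfl
  exact (dist_le p).trans hp

lemma dist_slideEdge_center_le (hT : T.IsTree) (hbw : b ≠ w)
    (hv : ∀ x, T.Adj v x ↔ x = b ∨ x = w) {y : V} (hy : y ≠ v) :
    (slideEdge T v b w).dist b y ≤ T.dist v y := by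
  have hbv : b ≠ v := ((hv b).2 (Or.inl rfl)).ne'
  obtain ⟨z, hvz, hz⟩ := exists_adj_dist_add_one hT.connected hy.symm
  rcases (hv z).1 hvz with rfl | rfl
  · have := dist_slideEdge_le hT.connected hbw hv hbv hy
    omega
  · have h₁ := dist_slideEdge_le hT.connected hbw hv hvz.ne' hy
    have h₂ := (slideEdge_connected hT.connected hbw hv).dist_triangle (u := b) (v := z) (w := y)
    rw [dist_eq_one_iff_adj.2 ((slideEdge_adj hbv hbw).2 (by simp) :
      (slideEdge T v b z).Adj b z)] at h₂
    omega

variable [Fintype V]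

lemma deg_slideEdge_left (hbw : b ≠ w) (hv : ∀ x, T.Adj v x ↔ x = b ∨ x = w) :
    deg (slideEdge T v b w) v = 1 := by
  classical
  have hbv : b ≠ v := ((hv b).2 (Or.inl rfl)).ne'
  have hwv : w ≠ v := ((hv w).2 (Or.inr rfl)).ne'
  refine Finset.card_eq_one.2 ⟨b, ?_⟩
  ext y
  simp only [Finset.mem_filter, Finset.mem_univ, true_and, slideEdge_adj hbv hbw,
    Finset.mem_singleton]
  grind

lemma deg_slideEdge_center (hbw : b ≠ w) (hv : ∀ x, T.Adj v x ↔ x = b ∨ x = w)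
    (hnadj : ¬ T.Adj b w) : deg (slideEdge T v b w) b = deg T b + 1 := by
  classical
  have hbv : b ≠ v := ((hv b).2 (Or.inl rfl)).ne'
  have hwv : w ≠ v := ((hv w).2 (Or.inr rfl)).ne'
  have hadj : T.Adj b v := ((hv b).2 (Or.inl rfl)).symm
  rw [deg, deg, ← Finset.card_insert_of_notMem (a := w) (by simpa using hnadj)]
  congr 1
  ext y
  simp only [Finset.mem_filter, Finset.mem_univ, true_and, slideEdge_adj hbv hbw,
    Finset.mem_insert]
  grind

lemma deg_slideEdge_of_ne (hbw : b ≠ w) (hv : ∀ x, T.Adj v x ↔ x = b ∨ x = w)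
    (hnadj : ¬ T.Adj b w) {u : V} (huv : u ≠ v) (hub : u ≠ b) :
    deg (slideEdge T v b w) u = deg T u := by
  classical
  have hbv : b ≠ v := ((hv b).2 (Or.inl rfl)).ne'
  have hwv : w ≠ v := ((hv w).2 (Or.inr rfl)).ne'
  by_cases huw : u = w
  · subst huw
    have hadj : T.Adj u v := ((hv u).2 (Or.inr rfl)).symm
    have hnadj' : ¬ T.Adj u b := fun h => hnadj h.symm
    refine Finset.card_equiv (Equiv.swap b v) fun y => ?_
    simp only [Finset.mem_filter, Finset.mem_univ, true_and, slideEdge_adj hbv hbw]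
    by_cases hyb : y = b
    · simp [hyb, hadj, hub]
    by_cases hyv : y = v
    · simp [hyv, hnadj', huv, hub, hbv.symm]
    rw [Equiv.swap_apply_of_ne_of_ne hyb hyv]
    grind
  · have hnadj' : ¬ T.Adj u v := fun h => by
      rcases (hv u).1 h.symm with h | h <;> contradiction
    rw [deg, deg]
    congr 1
    ext y
    simp only [Finset.mem_filter, Finset.mem_univ, true_and, slideEdge_adj hbv hbw]
    grind

lemma sum_deg_eq_two_mul_card_edgeSet (G : SimpleGraph V) :
    ∑ u, deg G u = 2 * Nat.card G.edgeSet := by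
  classical
  rw [Nat.card_eq_fintype_card, ← edgeFinset_card, ← sum_degrees_eq_twice_card_edges]
  exact Finset.sum_congr rfl fun u _ => deg_eq_degree G u

lemma slideEdge_isTree (hT : T.IsTree) (hbw : b ≠ w) (hv : ∀ x, T.Adj v x ↔ x = b ∨ x = w)
    (hnadj : ¬ T.Adj b w) (hdeg : deg T v = 2) : (slideEdge T v b w).IsTree := by
  classical
  have hbv : b ≠ v := ((hv b).2 (Or.inl rfl)).ne'
  refine isTree_iff_connected_and_card.2 ⟨slideEdge_connected hT.connected hbw hv, ?_⟩
  rw [← (isTree_iff_connected_and_card.1 hT).2]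
  have h₁ := sum_deg_eq_two_mul_card_edgeSet T
  have h₂ := sum_deg_eq_two_mul_card_edgeSet (slideEdge T v b w)
  have hmem : b ∈ Finset.univ.erase v := by simpa using hbv
  rw [← Finset.add_sum_erase _ _ (Finset.mem_univ v), ← Finset.add_sum_erase _ _ hmem] at h₁ h₂
  rw [deg_slideEdge_left hbw hv, deg_slideEdge_center hbw hv hnadj,
    Finset.sum_congr rfl fun u hu => deg_slideEdge_of_ne hbw hv hnadj
      (Finset.ne_of_mem_erase (Finset.mem_of_mem_erase hu)) (Finset.ne_of_mem_erase hu)] at h₂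
  omega

lemma branchCount_slideEdge (hbw : b ≠ w) (hv : ∀ x, T.Adj v x ↔ x = b ∨ x = w)
    (hnadj : ¬ T.Adj b w) (hdeg : deg T v = 2) (hb : 3 ≤ deg T b) :
    branchCount (slideEdge T v b w) = branchCount T := by
  rw [branchCount, branchCount]
  congr 1
  ext u
  simp only [Finset.mem_filter, Finset.mem_univ, true_and]
  by_cases huv : u = v
  · rw [huv, deg_slideEdge_left hbw hv, hdeg]; omega
  by_cases hub : u = b
  · rw [hub, deg_slideEdge_center hbw hv hnadj]; omega
  rw [deg_slideEdge_of_ne hbw hv hnadj huv hub]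

lemma ecc_slideEdge_le (hT : T.IsTree) (hbw : b ≠ w) (hv : ∀ x, T.Adj v x ↔ x = b ∨ x = w)
    (hb : 2 ≤ deg T b) {x : V} (hx : x ≠ v) : ecc (slideEdge T v b w) x ≤ ecc T x := by
  have hbv : b ≠ v := ((hv b).2 (Or.inl rfl)).ne'
  refine Finset.sup_le fun y _ => ?_
  by_cases hy : y = v
  · subst hy
    obtain ⟨c, hc⟩ := exists_dist_eq_add_one_of_two_le_deg hT hb x
    have h₁ := dist_slideEdge_le hT.connected hbw hv hx hbv
    have h₂ := (slideEdge_connected hT.connected hbw hv).dist_triangle (u := x) (v := b) (w := y)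
    rw [dist_eq_one_iff_adj.2 ((slideEdge_adj hbv hbw).2 (by simp) :
      (slideEdge T y b w).Adj b y)] at h₂
    have h₃ := dist_le_ecc T x c
    omega
  · exact (dist_slideEdge_le hT.connected hbw hv hx hy).trans (dist_le_ecc T x y)

/-- The eccentricity of `b` after the slide is below that of `v` before it, unless the latter
was smaller than the eccentricity of `b`. -/
lemma ecc_slideEdge_center (hT : T.IsTree) (hbw : b ≠ w)
    (hv : ∀ x, T.Adj v x ↔ x = b ∨ x = w) (hb : 2 ≤ deg T b) :
    ecc (slideEdge T v b w) b < ecc T v ∨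
      (ecc (slideEdge T v b w) b ≤ ecc T v ∧ ecc T v < ecc T b) := by
  have hadj : T.Adj v b := (hv b).2 (Or.inl rfl)
  have hbv : b ≠ v := hadj.ne'
  obtain ⟨y, hy⟩ := exists_dist_eq_ecc (slideEdge T v b w) b
  rw [← hy]
  by_cases hyv : y = v
  · left
    subst hyv
    obtain ⟨c, hc⟩ := exists_dist_eq_add_one_of_two_le_deg hT hb y
    have := dist_le_ecc T y c
    rw [dist_eq_one_iff_adj.2 ((slideEdge_adj hbv hbw).2 (by simp) :
      (slideEdge T y b w).Adj b y)]
    rw [dist_eq_one_iff_adj.2 hadj] at hc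
    omega
  · have h₁ := dist_slideEdge_center_le hT hbw hv hyv
    have h₂ := dist_slideEdge_le hT.connected hbw hv hbv hyv
    have h₃ := dist_le_ecc T v y
    have h₄ := dist_le_ecc T b y
    have h₅ := hT.dist_eq_dist_add_one_of_adj y hadj
    rw [T.dist_comm (u := y) (v := v), T.dist_comm (u := y) (v := b)] at h₅
    omega

lemma ecc_slideEdge_left_le (hT : T.IsTree) (hbw : b ≠ w)
    (hv : ∀ x, T.Adj v x ↔ x = b ∨ x = w) :
    ecc (slideEdge T v b w) v ≤ ecc (slideEdge T v b w) b + 1 := by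
  have hbv : b ≠ v := ((hv b).2 (Or.inl rfl)).ne'
  refine Finset.sup_le fun y _ => ?_
  have h₁ := (slideEdge_connected hT.connected hbw hv).dist_triangle (u := v) (v := b) (w := y)
  rw [dist_eq_one_iff_adj.2 ((slideEdge_adj hbv hbw).2 (by simp) :
    (slideEdge T v b w).Adj v b)] at h₁
  have h₂ := dist_le_ecc (slideEdge T v b w) b y
  omega

lemma cei_lt_cei_slideEdge (hT : T.IsTree) (hbw : b ≠ w)
    (hv : ∀ x, T.Adj v x ↔ x = b ∨ x = w) (hnadj : ¬ T.Adj b w) (hdeg : deg T v = 2)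
    (hb : 3 ≤ deg T b) : cei T < cei (slideEdge T v b w) := by
  classical
  have hbv : b ≠ v := ((hv b).2 (Or.inl rfl)).ne'
  have hmem : b ∈ Finset.univ.erase v := by simpa using hbv
  have hadj : (slideEdge T v b w).Adj b v := (slideEdge_adj hbv hbw).2 (by simp)
  rw [cei, cei, ← Finset.add_sum_erase _ _ (Finset.mem_univ v), ← Finset.add_sum_erase _ _ hmem,
    ← Finset.add_sum_erase (Finset.univ : Finset V) _ (Finset.mem_univ v),
    ← Finset.add_sum_erase (Finset.univ.erase v) _ hmem, ← add_assoc, ← add_assoc]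
  refine add_lt_add_of_lt_of_le ?_ (Finset.sum_le_sum fun u hu => ?_)
  · rw [deg_slideEdge_left hbw hv, deg_slideEdge_center hbw hv hnadj, hdeg]
    push_cast
    exact two_div_add_div_lt (by omega) (ecc_pos_of_adj hadj.symm) (ecc_pos_of_adj hadj)
      (ecc_slideEdge_left_le hT hbw hv) (ecc_slideEdge_le hT hbw hv (by omega) hbv)
      (ecc_slideEdge_center hT hbw hv (by omega))
  · have hub := Finset.ne_of_mem_erase hu
    have huv := Finset.ne_of_mem_erase (Finset.mem_of_mem_erase hu)
    obtain ⟨z, hz, -⟩ := exists_adj_dist_add_one (slideEdge_connected hT.connected hbw hv) huv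
    rw [deg_slideEdge_of_ne hbw hv hnadj huv hub]
    exact div_le_div_of_nonneg_left (by positivity) (by exact_mod_cast ecc_pos_of_adj hz)
      (by exact_mod_cast ecc_slideEdge_le hT hbw hv (by omega) huv)

end Slide

/-- a tree `T` on `n` vertices with exactly `r` branching vertices
(`1 ≤ r ≤ n/2 - 1`) maximizing the connective eccentricity index among all such
trees has no vertex of degree two; consequently every vertex is either a pendant
vertex or one of the `r` branching vertices (of degree `≥ 3`), i.e. the degree
sequence is `(d₁,…,d_r,1,…,1)` with each `dᵢ ≥ 3`. -/
theorem no_degree_two_of_cei_max {n r : ℕ} (hr : 1 ≤ r) (hrn : 2 * r + 2 ≤ n)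
    [Fintype V] (hcard : Fintype.card V = n)
    (T : SimpleGraph V) (hT : T.IsTree) (hbr : branchCount T = r)
    (hmax : ∀ T' : SimpleGraph (Fin n), T'.IsTree → branchCount T' = r →
      cei T' ≤ cei T) :
    (∀ v, deg T v ≠ 2) ∧ (∀ v, deg T v = 1 ∨ 3 ≤ deg T v) := by
  have hno : ∀ v, deg T v ≠ 2 := by
    intro v₀ hv₀
    obtain ⟨b₀, hb₀⟩ := Finset.card_pos.1 (show 0 < branchCount T by omega)
    obtain ⟨v, b, hvb, hdeg, hb⟩ := exists_adj_deg_eq_two_three_le_deg hT.connected hv₀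
      (Finset.mem_filter.1 hb₀).2
    obtain ⟨w, hwb, hv⟩ := exists_ne_adj_of_deg_eq_two hdeg hvb
    have hnadj : ¬ T.Adj b w := fun h => by
      refine hT.dist_ne_of_adj v h ?_
      rw [dist_eq_one_iff_adj.2 hvb, dist_eq_one_iff_adj.2 ((hv w).2 (Or.inr rfl))]
    have hT' := slideEdge_isTree hT hwb.symm hv hnadj hdeg
    let f := SimpleGraph.Iso.map (Fintype.equivFinOfCardEq hcard) (slideEdge T v b w)
    have hle := hmax _ (f.isTree_iff.1 hT')
      (by rw [branchCount_iso f, branchCount_slideEdge hwb.symm hv hnadj hdeg hb, hbr])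
    rw [cei_iso f hT'.connected] at hle
    exact (cei_lt_cei_slideEdge hT hwb.symm hv hnadj hdeg hb).not_ge hle
  refine ⟨hno, fun v => ?_⟩
  have : Nontrivial V := Fintype.one_lt_card_iff_nontrivial.1 (by omega)
  obtain ⟨u, hu⟩ := exists_ne v
  obtain ⟨z, hz, -⟩ := exists_adj_dist_add_one hT.connected hu.symm
  have hpos : 0 < deg T v := Finset.card_pos.2 ⟨z, by simpa using hz⟩
  have := hno v
  omega
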